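/- arXiv:2105.04226 — 5 statements merged into one kernel-verified Lean document; each statement's English description precedes it below -/
import Mathlib

section
/- Let d ≥ 1 and let V, F : ℝ^d → ℝ be twice continuously differentiable. Let β₀, β₁ ∈ ℝ, β₂ > 0, β₃ ≥ 0, α₃ ≥ 0 and γ₀ ∈ [0,3). Assume that ⟨(∇²V(x) + ∇²F(x − y))v, v⟩ ≥ (β₀ − 2β₁|x| + 3β₂|x|² − β₃|y|²)|v|² for all x, y, v ∈ ℝ^d, and that ‖∇²F(z)‖ ≤ α₃(1 + |z|^{γ₀}) for all z ∈ ℝ^d. Then for every probability measure μ on ℝ^d with ∫|y|⁴ dμ(y) < ∞ and every x ∈ ℝ^d one has ⟨∇V(x) − ∇V(0), x⟩ + ∫ ⟨∇F(x − y) − ∇F(−y), x⟩ dμ(y) ≥ (β₂|x|² − β₁|x| + β₀ − β₃ ∫|y|² dμ(y)) |x|². -/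
open MeasureTheory RealInnerProductSpace

lemma inner_gradient_left_eq_fderiv {E : Type*} [NormedAddCommGroup E] [InnerProductSpace ℝ E]
    [CompleteSpace E] (G : E → ℝ) (z v : E) : ⟪gradient G z, v⟫ = fderiv ℝ G z v := by
  simp [gradient, InnerProductSpace.toDual_symm_apply]

/-- The directional derivative along a line has the Hessian as its derivative. -/
lemma hasDerivAt_fderiv_line {E : Type*} [NormedAddCommGroup E] [NormedSpace ℝ E] {G : E → ℝ}
    (hG : ContDiff ℝ 2 G) (a v : E) (t : ℝ) :
    HasDerivAt (fun s : ℝ => fderiv ℝ G (a + s • v) v)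
      (iteratedFDeriv ℝ 2 G (a + t • v) ![v, v]) t := by
  have h1 : HasFDerivAt (fderiv ℝ G) (fderiv ℝ (fderiv ℝ G) (a + t • v)) (a + t • v) :=
    (((hG.fderiv_right (m := 1) (by norm_num)).differentiable one_ne_zero) _).hasFDerivAt
  have h2 : HasDerivAt (fun s : ℝ => a + s • v) v t := by
    simpa using ((hasDerivAt_id t).smul_const v).const_add a
  rw [iteratedFDeriv_two_apply]
  exact (ContinuousLinearMap.apply ℝ ℝ v).hasFDerivAt.comp_hasDerivAt t
    (h1.comp_hasDerivAt t h2)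

/-- Increments of a directional derivative are controlled by the Hessian. -/
lemma abs_fderiv_add_sub_fderiv_le {E : Type*} [NormedAddCommGroup E] [NormedSpace ℝ E]
    {G : E → ℝ} (hG : ContDiff ℝ 2 G) (a v : E) {C : ℝ}
    (hC : ∀ t ∈ Set.Icc (0 : ℝ) 1, ‖iteratedFDeriv ℝ 2 G (a + t • v)‖ ≤ C) :
    |fderiv ℝ G (a + v) v - fderiv ℝ G a v| ≤ C * ‖v‖ ^ 2 := by
  have h := norm_image_sub_le_of_norm_deriv_le_segment_01'
    (f := fun s : ℝ => fderiv ℝ G (a + s • v) v) (C := C * ‖v‖ ^ 2)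
    (fun t _ => (hasDerivAt_fderiv_line hG a v t).hasDerivWithinAt) (fun t ht => by
      refine (ContinuousMultilinearMap.le_opNorm _ _).trans ?_
      have := hC t ⟨ht.1, ht.2.le⟩
      simp only [Fin.prod_univ_two, Matrix.cons_val_zero, Matrix.cons_val_one, ← pow_two]
      gcongr)
  simpa using h

lemma rpow_le_one_add_pow_four {r γ : ℝ} (hr : 0 ≤ r) (hγ : 0 ≤ γ) (hγ' : γ ≤ 4) :
    r ^ γ ≤ 1 + r ^ 4 := by
  rcases le_total r 1 with h | h
  · have := Real.rpow_le_one hr h hγ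
    have := pow_nonneg hr 4
    linarith
  · have := Real.rpow_le_rpow_of_exponent_le h hγ'
    rw [show (4 : ℝ) = ((4 : ℕ) : ℝ) by norm_num, Real.rpow_natCast] at this
    linarith

/-- A quadratic lower bound on a derivative, integrated over the unit interval. -/
lemma le_sub_of_quadratic_le_deriv {f f' : ℝ → ℝ} {a b c : ℝ}
    (hf : ∀ t, HasDerivAt f (f' t) t)
    (h : ∀ t ∈ Set.Icc (0 : ℝ) 1, a + 2 * b * t + 3 * c * t ^ 2 ≤ f' t) :
    a + b + c ≤ f 1 - f 0 := by
  have hg : ∀ t, HasDerivAt (fun t => f t - (a * t + b * t ^ 2 + c * t ^ 3))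
      (f' t - (a + 2 * b * t + 3 * c * t ^ 2)) t := fun t => by
    have h1 := (hasDerivAt_id' t).const_mul a
    have h2 := (hasDerivAt_pow 2 t).const_mul b
    have h3 := (hasDerivAt_pow 3 t).const_mul c
    refine ((hf t).fun_sub ((h1.fun_add h2).fun_add h3)).congr_deriv ?_
    norm_num
    ring
  have hm := monotoneOn_of_hasDerivWithinAt_nonneg (convex_Icc (0 : ℝ) 1)
    (fun t _ => (hg t).continuousAt.continuousWithinAt)
    (fun t _ => (hg t).hasDerivWithinAt)
    (fun t ht => sub_nonneg.2 (h t (interior_subset ht)))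
  have := hm (Set.left_mem_Icc.2 zero_le_one) (Set.right_mem_Icc.2 zero_le_one) zero_le_one
  norm_num at this
  linarith

/-- Inequality (2.33) in the proof of Corollary 2.2: under the Hessian lower bound
on `∇²V + ∇²F` and the growth bound on `∇²F`, for every probability measure `μ`
with finite fourth moment one has
`⟨∇V(x) − ∇V(0), x⟩ + ∫ ⟨∇F(x−y) − ∇F(−y), x⟩ dμ(y)
  ≥ (β₂|x|² − β₁|x| + β₀ − β₃ ∫|y|² dμ) |x|²`. -/
theorem hessian_lower_bound_integrated (d : ℕ) (hd : 1 ≤ d)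
    (V F : EuclideanSpace ℝ (Fin d) → ℝ) (hV : ContDiff ℝ 2 V) (hF : ContDiff ℝ 2 F)
    (β₀ β₁ β₂ β₃ α₃ γ₀ : ℝ) (hβ₂ : 0 < β₂) (hβ₃ : 0 ≤ β₃) (hα₃ : 0 ≤ α₃)
    (hγ₀ : 0 ≤ γ₀) (hγ₀' : γ₀ < 3)
    (hHess : ∀ x y v : EuclideanSpace ℝ (Fin d),
      (β₀ - 2 * β₁ * ‖x‖ + 3 * β₂ * ‖x‖ ^ 2 - β₃ * ‖y‖ ^ 2) * ‖v‖ ^ 2 ≤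
        iteratedFDeriv ℝ 2 V x ![v, v] + iteratedFDeriv ℝ 2 F (x - y) ![v, v])
    (hF2 : ∀ z : EuclideanSpace ℝ (Fin d),
      ‖iteratedFDeriv ℝ 2 F z‖ ≤ α₃ * (1 + ‖z‖ ^ γ₀))
    (μ : Measure (EuclideanSpace ℝ (Fin d))) [IsProbabilityMeasure μ]
    (hμ : Integrable (fun y => ‖y‖ ^ 4) μ) (x : EuclideanSpace ℝ (Fin d)) :
    (β₂ * ‖x‖ ^ 2 - β₁ * ‖x‖ + β₀ - β₃ * ∫ y, ‖y‖ ^ 2 ∂μ) * ‖x‖ ^ 2 ≤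
      ⟪gradient V x - gradient V 0, x⟫ +
        ∫ y, ⟪gradient F (x - y) - gradient F (-y), x⟫ ∂μ := by
  simp only [inner_sub_left, inner_gradient_left_eq_fderiv]
  have hpt : ∀ y, (β₂ * ‖x‖ ^ 2 - β₁ * ‖x‖ + β₀ - β₃ * ‖y‖ ^ 2) * ‖x‖ ^ 2 ≤
      fderiv ℝ V x x - fderiv ℝ V 0 x + (fderiv ℝ F (x - y) x - fderiv ℝ F (-y) x) := fun y => by
    have h := le_sub_of_quadratic_le_deriv (a := (β₀ - β₃ * ‖y‖ ^ 2) * ‖x‖ ^ 2)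
      (b := -β₁ * ‖x‖ ^ 3) (c := β₂ * ‖x‖ ^ 4)
      (fun t => (hasDerivAt_fderiv_line hV 0 x t).add (hasDerivAt_fderiv_line hF (-y) x t))
      (fun t ht => by
        have h := hHess (t • x) y x
        rw [norm_smul, Real.norm_of_nonneg ht.1] at h
        rw [zero_add, neg_add_eq_sub]
        linarith)
    simp only [Pi.add_apply, one_smul, zero_smul, zero_add, zero_sub, neg_add_eq_sub] at h
    linarith
  have hint : Integrable (fun y => fderiv ℝ F (x - y) x - fderiv ℝ F (-y) x) μ := by
    have hc : Continuous (fderiv ℝ F) := hF.continuous_fderiv two_ne_zero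
    refine Integrable.mono'
      (g := fun y => α₃ * (2 + 8 * (‖x‖ ^ 4 + ‖y‖ ^ 4)) * ‖x‖ ^ 2) ?_
      (by fun_prop : Continuous _).aestronglyMeasurable (.of_forall fun y => ?_)
    · exact (((integrable_const _).add (((integrable_const _).add hμ).const_mul 8)).const_mul
        α₃).mul_const _
    · rw [← neg_add_eq_sub y x]
      refine abs_fderiv_add_sub_fderiv_le hF (-y) x fun t ht => (hF2 _).trans ?_
      have hn : ‖-y + t • x‖ ≤ ‖x‖ + ‖y‖ := by
        refine (norm_add_le _ _).trans ?_
        rw [norm_neg, norm_smul, Real.norm_of_nonneg ht.1, add_comm]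
        gcongr
        exact mul_le_of_le_one_left (norm_nonneg x) ht.2
      have h1 := rpow_le_one_add_pow_four (norm_nonneg (-y + t • x)) hγ₀ (by linarith)
      have h2 := pow_le_pow_left₀ (norm_nonneg _) hn 4
      have h3 := add_pow_le (norm_nonneg x) (norm_nonneg y) 4
      norm_num at h3
      exact mul_le_mul_of_nonneg_left (by linarith) hα₃
  have hint2 : Integrable (fun y => ‖y‖ ^ 2) μ := by
    refine Integrable.mono' ((integrable_const 1).add hμ)
      (by fun_prop : Continuous _).aestronglyMeasurable (.of_forall fun y => ?_)
    rw [Real.norm_of_nonneg (by positivity), Pi.add_apply]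
    nlinarith [sq_nonneg (‖y‖ ^ 2 - 1)]
  have hmono := integral_mono
    (((integrable_const _).sub (hint2.const_mul β₃)).mul_const (‖x‖ ^ 2))
    ((integrable_const _).add hint) hpt
  simp only [Pi.sub_apply, Pi.add_apply] at hmono
  rw [integral_mul_const, integral_sub (integrable_const _) (hint2.const_mul β₃),
    integral_const_mul, integral_add (integrable_const _) hint] at hmono
  simpa using hmono
end

section
/- Let d ≥ 1 and let V, F : ℝ^d → ℝ be twice continuously differentiable. Let β₀, β₁ ∈ ℝ, β₂ > 0, β₃ ≥ 0, α₁, α₂ ≥ 0, α₃ ≥ 0 and γ₀ ∈ [0,3). Assume that ⟨(∇²V(x) + ∇²F(x − y))v, v⟩ ≥ (β₀ − 2β₁|x| + 3β₂|x|² − β₃|y|²)|v|² for all x, y, v ∈ ℝ^d, that |∇F(z)| ≤ α₁ + α₂|z|³ for all z, and that ‖∇²F(z)‖ ≤ α₃(1 + |z|^{γ₀}) for all z. Then for every probability measure μ on ℝ^d with ∫|y|⁴ dμ(y) < ∞ and every x ∈ ℝ^d one has ⟨∇V(x) + ∫ ∇F(x − y) dμ(y), x⟩ ≥ (β₂ −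 α₂/4 − β₃/2)|x|⁴ − β₁|x|³ + β₀|x|² − (|∇V(0)| + α₁)|x| − (3α₂/4 + β₃/2) ∫|y|⁴ dμ(y). -/
open MeasureTheory RealInnerProductSpace

/-- The derivative of `t ↦ DG(c + t x) x` is the second derivative of `G` evaluated twice at `x`. -/
theorem ContDiff.hasDerivAt_fderiv_lineMap {E : Type*} [NormedAddCommGroup E] [NormedSpace ℝ E]
    {G : E → ℝ} (hG : ContDiff ℝ 2 G) (c x : E) (t : ℝ) :
    HasDerivAt (fun s : ℝ => fderiv ℝ G (c + s • x) x)
      (iteratedFDeriv ℝ 2 G (c + t • x) ![x, x]) t := by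
  have hdiff : Differentiable ℝ (fderiv ℝ G) :=
    (hG.fderiv_right (m := 1) (by norm_num)).differentiable (by norm_num)
  have hline : HasDerivAt (fun s : ℝ => c + s • x) x t := by
    simpa using ((hasDerivAt_id t).smul_const x).const_add c
  have h := (hdiff (c + t • x)).hasFDerivAt.comp_hasDerivAt t hline
  simpa [iteratedFDeriv_two_apply] using h.clm_apply (hasDerivAt_const t x)

/-- A lower bound on the Hessian sum integrated along the segment from `0` to `x`. -/
theorem le_fderiv_sub_fderiv_of_hessian_lower_bound {E : Type*} [NormedAddCommGroup E]
    [NormedSpace ℝ E] {V F : E → ℝ} (hV : ContDiff ℝ 2 V) (hF : ContDiff ℝ 2 F)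
    {b₀ b₁ b₂ : ℝ} (x y : E)
    (h : ∀ z : E, (b₀ - 2 * b₁ * ‖z‖ + 3 * b₂ * ‖z‖ ^ 2) * ‖x‖ ^ 2 ≤
      iteratedFDeriv ℝ 2 V z ![x, x] + iteratedFDeriv ℝ 2 F (z - y) ![x, x]) :
    b₀ * ‖x‖ ^ 2 - b₁ * ‖x‖ ^ 3 + b₂ * ‖x‖ ^ 4 ≤
      fderiv ℝ V x x + fderiv ℝ F (x - y) x - (fderiv ℝ V 0 x + fderiv ℝ F (-y) x) := by
  have hpoly (t : ℝ) : HasDerivAt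
      (fun s : ℝ => b₀ * ‖x‖ ^ 2 * s - b₁ * ‖x‖ ^ 3 * s ^ 2 + b₂ * ‖x‖ ^ 4 * s ^ 3)
      (b₀ * ‖x‖ ^ 2 - b₁ * ‖x‖ ^ 3 * (2 * t) + b₂ * ‖x‖ ^ 4 * (3 * t ^ 2)) t := by
    refine ((((hasDerivAt_id t).const_mul (b₀ * ‖x‖ ^ 2)).sub
      ((hasDerivAt_pow 2 t).const_mul (b₁ * ‖x‖ ^ 3))).add
      ((hasDerivAt_pow 3 t).const_mul (b₂ * ‖x‖ ^ 4))).congr_deriv ?_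
    norm_num
  have hderiv (t : ℝ) := ((hV.hasDerivAt_fderiv_lineMap 0 x t).add
    (hF.hasDerivAt_fderiv_lineMap (-y) x t)).sub (hpoly t)
  have hmono := monotoneOn_of_hasDerivWithinAt_nonneg (convex_Icc (0 : ℝ) 1)
    (fun t _ => (hderiv t).continuousAt.continuousWithinAt)
    (fun t _ => (hderiv t).hasDerivWithinAt) (by
      intro t ht
      rw [interior_Icc] at ht
      have ht' := h (t • x)
      rw [norm_smul, Real.norm_of_nonneg ht.1.le] at ht'
      rw [zero_add, neg_add_eq_sub]
      linarith)
  have h01 := hmono (Set.left_mem_Icc.2 zero_le_one) (Set.right_mem_Icc.2 zero_le_one) zero_le_one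
  simp only [Pi.add_apply, Pi.sub_apply, zero_smul, one_smul, zero_add, neg_add_eq_sub,
    zero_sub] at h01
  linarith

/-- A continuous vector field of cubic growth is integrable against every translate of a finite
measure with finite fourth moment. -/
theorem MeasureTheory.Integrable.comp_sub_of_norm_le_cube {E E' : Type*} [NormedAddCommGroup E]
    [MeasurableSpace E] [BorelSpace E] [SecondCountableTopology E] [NormedAddCommGroup E']
    {μ : Measure E} [IsFiniteMeasure μ] (hμ : Integrable (fun y => ‖y‖ ^ 4) μ) {g : E → E'}
    (hg : Continuous g) {a b : ℝ} (hb : 0 ≤ b) (hbound : ∀ z, ‖g z‖ ≤ a + b * ‖z‖ ^ 3) (x : E) :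
    Integrable (fun y => g (x - y)) μ := by
  refine ((hμ.const_mul (8 * b)).add (integrable_const (a + b * (1 + 8 * ‖x‖ ^ 4)))).mono'
    (by fun_prop : Continuous fun y => g (x - y)).aestronglyMeasurable (.of_forall fun y => ?_)
  have hcube : ‖x - y‖ ^ 3 ≤ (‖x‖ + ‖y‖) ^ 3 := by gcongr; exact norm_sub_le x y
  have hquart : (‖x‖ + ‖y‖) ^ 3 ≤ 1 + (‖x‖ + ‖y‖) ^ 4 := by
    have hs : 0 ≤ ‖x‖ + ‖y‖ := by positivity
    generalize ‖x‖ + ‖y‖ = s at hs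
    nlinarith [sq_nonneg (s ^ 2 - s), sq_nonneg (s - 1), sq_nonneg (s ^ 2 - 1)]
  have hpow := add_pow_le (norm_nonneg x) (norm_nonneg y) 4
  norm_num at hpow
  calc ‖g (x - y)‖ ≤ a + b * ‖x - y‖ ^ 3 := hbound _
    _ ≤ a + b * (1 + 8 * (‖x‖ ^ 4 + ‖y‖ ^ 4)) := by gcongr; linarith
    _ = _ := by simp only [Pi.add_apply]; ring

/-- Dissipativity estimate (2.37) in the proof of Corollary 2.2 for the
McKean–Vlasov drift `b(x, μ) = −∇V(x) − (∇F ∗ μ)(x)`. -/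
theorem mckean_vlasov_dissipativity (d : ℕ) (hd : 1 ≤ d)
    (V F : EuclideanSpace ℝ (Fin d) → ℝ) (hV : ContDiff ℝ 2 V) (hF : ContDiff ℝ 2 F)
    (β₀ β₁ β₂ β₃ α₁ α₂ α₃ γ₀ : ℝ) (hβ₂ : 0 < β₂) (hβ₃ : 0 ≤ β₃)
    (hα₁ : 0 ≤ α₁) (hα₂ : 0 ≤ α₂) (hα₃ : 0 ≤ α₃) (hγ₀ : 0 ≤ γ₀) (hγ₀' : γ₀ < 3)
    (hHess : ∀ x y v : EuclideanSpace ℝ (Fin d),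
      (β₀ - 2 * β₁ * ‖x‖ + 3 * β₂ * ‖x‖ ^ 2 - β₃ * ‖y‖ ^ 2) * ‖v‖ ^ 2 ≤
        iteratedFDeriv ℝ 2 V x ![v, v] + iteratedFDeriv ℝ 2 F (x - y) ![v, v])
    (hF1 : ∀ z : EuclideanSpace ℝ (Fin d), ‖gradient F z‖ ≤ α₁ + α₂ * ‖z‖ ^ 3)
    (hF2 : ∀ z : EuclideanSpace ℝ (Fin d),
      ‖iteratedFDeriv ℝ 2 F z‖ ≤ α₃ * (1 + ‖z‖ ^ γ₀))
    (μ : Measure (EuclideanSpace ℝ (Fin d))) [IsProbabilityMeasure μ]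
    (hμ : Integrable (fun y => ‖y‖ ^ 4) μ) (x : EuclideanSpace ℝ (Fin d)) :
    (β₂ - α₂ / 4 - β₃ / 2) * ‖x‖ ^ 4 - β₁ * ‖x‖ ^ 3 + β₀ * ‖x‖ ^ 2
        - (‖gradient V 0‖ + α₁) * ‖x‖ - (3 * α₂ / 4 + β₃ / 2) * ∫ y, ‖y‖ ^ 4 ∂μ ≤
      ⟪gradient V x + ∫ y, gradient F (x - y) ∂μ, x⟫ := by
  have hfderiv (G : EuclideanSpace ℝ (Fin d) → ℝ) (z v : EuclideanSpace ℝ (Fin d)) :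
      fderiv ℝ G z v = ⟪gradient G z, v⟫ := by
    simp [gradient]
  have hlower (G : EuclideanSpace ℝ (Fin d) → ℝ) (z : EuclideanSpace ℝ (Fin d)) :
      -(‖gradient G z‖ * ‖x‖) ≤ ⟪gradient G z, x⟫ :=
    neg_le_of_abs_le (abs_real_inner_le_norm _ _)
  have hcont : Continuous (gradient F) :=
    (InnerProductSpace.toDual ℝ _).symm.continuous.comp (hF.continuous_fderiv (by norm_num))
  have hint : Integrable (fun y => gradient F (x - y)) μ :=
    hμ.comp_sub_of_norm_le_cube hcont hα₂ hF1 x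
  have hpoint (y : EuclideanSpace ℝ (Fin d)) :
      (β₂ - α₂ / 4 - β₃ / 2) * ‖x‖ ^ 4 - β₁ * ‖x‖ ^ 3 + β₀ * ‖x‖ ^ 2
          - (‖gradient V 0‖ + α₁) * ‖x‖ - ⟪gradient V x, x⟫
          - (3 * α₂ / 4 + β₃ / 2) * ‖y‖ ^ 4 ≤ ⟪gradient F (x - y), x⟫ := by
    have hsegment := le_fderiv_sub_fderiv_of_hessian_lower_bound hV hF
      (b₀ := β₀ - β₃ * ‖y‖ ^ 2) (b₁ := β₁) (b₂ := β₂) x y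
      (fun z => le_of_eq_of_le (by ring) (hHess z y x))
    simp only [hfderiv] at hsegment
    have hgrowth : ‖gradient F (-y)‖ * ‖x‖ ≤ (α₁ + α₂ * ‖y‖ ^ 3) * ‖x‖ := by
      gcongr
      simpa using hF1 (-y)
    have hyoung : ‖y‖ ^ 3 * ‖x‖ ≤ 3 / 4 * ‖y‖ ^ 4 + 1 / 4 * ‖x‖ ^ 4 := by
      nlinarith [sq_nonneg (‖y‖ ^ 2 - ‖x‖ ^ 2), sq_nonneg (‖y‖ ^ 2 - ‖y‖ * ‖x‖)]
    have hyoung' : ‖y‖ ^ 2 * ‖x‖ ^ 2 ≤ 1 / 2 * ‖y‖ ^ 4 + 1 / 2 * ‖x‖ ^ 4 := by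
      nlinarith [sq_nonneg (‖y‖ ^ 2 - ‖x‖ ^ 2)]
    linarith [mul_le_mul_of_nonneg_left hyoung hα₂, mul_le_mul_of_nonneg_left hyoung' hβ₃,
      hlower V 0, hlower F (-y)]
  have hmean := integral_mono ((integrable_const _).sub (hμ.const_mul _))
    (hint.inner_const x) hpoint
  rw [integral_sub' (integrable_const _) (hμ.const_mul _), integral_const_mul] at hmean
  have hinner : ∫ y, ⟪gradient F (x - y), x⟫ ∂μ = ⟪∫ y, gradient F (x - y) ∂μ, x⟫ := by
    simp_rw [real_inner_comm x]
    exact integral_inner hint x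
  rw [hinner] at hmean
  simp only [integral_const, probReal_univ, one_smul] at hmean
  rw [inner_add_left]
  linarith
end

section
/- Let β₀, β₂ > 0, β₁ ≥ 0 with β₁² < (8/3) β₀ β₂, let α₁, α₂ ≥ 0, s ≥ 0 and κ > 0, and assume s < 2κ(β₂κ³ − β₁κ² + (β₀ − α₂)κ − α₁). Then for every r₁ ∈ [0, κ] and every r ≥ κ: 2(β₂ r⁴ − β₁ r³ + β₀ r² − (α₁ + α₂ r₁) r) − s > 0. -/
/-- Verification of condition (2.16) in Corollary 2.4: the dissipativity quartic
`g(r, r₁) = 2(β₂ r⁴ − β₁ r³ + β₀ r² − (α₁ + α₂ r₁) r) − s` is strictly positive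
for `r ≥ κ` and `0 ≤ r₁ ≤ κ`. -/
theorem quartic_positivity (β₀ β₁ β₂ α₁ α₂ s κ : ℝ)
    (hβ₀ : 0 < β₀) (hβ₂ : 0 < β₂) (hβ₁ : 0 ≤ β₁)
    (hdisc : β₁ ^ 2 < (8 / 3) * β₀ * β₂)
    (hα₁ : 0 ≤ α₁) (hα₂ : 0 ≤ α₂) (hs : 0 ≤ s) (hκ : 0 < κ)
    (hsκ : s < 2 * κ * (β₂ * κ ^ 3 - β₁ * κ ^ 2 + (β₀ - α₂) * κ - α₁)) :
    ∀ r₁ ∈ Set.Icc (0 : ℝ) κ, ∀ r : ℝ, κ ≤ r →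
      0 < 2 * (β₂ * r ^ 4 - β₁ * r ^ 3 + β₀ * r ^ 2 - (α₁ + α₂ * r₁) * r) - s := by
  rintro r₁ ⟨-, hr₁⟩ r hr
  have hr0 : 0 < r := hκ.trans_le hr
  have hslope : 0 < β₂ * (r ^ 2 + r * κ + κ ^ 2) - β₁ * (r + κ) + β₀ := by
    refine pos_of_mul_pos_right (a := β₂) ?_ hβ₂.le
    nlinarith [sq_nonneg (3 * β₂ * (r + κ) - 2 * β₁), sq_nonneg (β₂ * (r - κ))]
  have hcubic : 0 < β₂ * κ ^ 3 - β₁ * κ ^ 2 + (β₀ - α₂) * κ - α₁ :=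
    pos_of_mul_pos_right (hs.trans_lt hsκ) (by positivity)
  have hr₁r : α₂ * r₁ * r ≤ α₂ * κ * r := by gcongr
  have hdiff := mul_nonneg (sub_nonneg.2 hr)
    (add_pos (mul_pos hr0 hslope) hcubic).le
  linear_combination hsκ + 2 * hr₁r + 2 * hdiff
end

section
/- Let β, α > 0, let a₁, a₂ ∈ ℝ with a₁a₂ < 0 and a₁² + a₂² + 2(a₁ − a₂)² + max(a₁², a₂²) < 8α/β, let s ≥ 0, and let κ ∈ (0, min(|a₁|, |a₂|)/2) satisfy s < 2βκ²(κ − |a₁ − a₂|)(κ − min(|a₁|, |a₂|)). Then for every r₁ ∈ [0, κ] and every r ≥ κ: 2β( r⁴ − |2a₁ − a₂| r³ + (a₁(a₁ − a₂) + α/β) r² ) − 2α r₁ r − s > 0. -/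
/-- Lower bound for the quartic `r²(r - a)(r - a - c) + A r (r - κ)` on `[κ, ∞)` by its value
at `κ`, by Taylor expansion at `κ`. -/
theorem quartic_ge_value_at_left_endpoint {a c A κ r : ℝ} (hc : 0 ≤ c)
    (hκ0 : 0 ≤ κ) (hκ : 2 * κ ≤ a) (hA : 4 * a ^ 2 + 4 * a * c + 3 * c ^ 2 ≤ 8 * A)
    (hr : κ ≤ r) :
    κ ^ 2 * (a - κ) * (a + c - κ) ≤ r ^ 2 * (r - a) * (r - a - c) + A * r * (r - κ) := by
  have hd : 0 ≤ r - κ := sub_nonneg.2 hr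
  have hA0 : 0 ≤ A := by nlinarith [sq_nonneg (2 * a + c), sq_nonneg c]
  have hslope : 0 ≤ 2 * (a - κ) * (a + c - κ) - κ * (2 * a + c - 2 * κ) + A := by
    nlinarith [mul_nonneg (sub_nonneg.2 hκ) (by linarith : 0 ≤ a + c - κ), mul_nonneg hκ0 hc]
  have hcurv : 0 ≤ 6 * κ ^ 2 - 3 * κ * (2 * a + c) + a * (a + c) + A
      + (4 * κ - (2 * a + c)) * (r - κ) + (r - κ) ^ 2 := by
    nlinarith [sq_nonneg (2 * (r - κ) + (4 * κ - (2 * a + c))), sq_nonneg (4 * κ - (2 * a + c))]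
  nlinarith [mul_nonneg (mul_nonneg hκ0 hd) hslope, mul_nonneg (sq_nonneg (r - κ)) hcurv]


/-- Polynomial verification in Example 2.1 (quadratic interaction): the
dissipativity function `g(r, r₁) = 2β(r⁴ − |2a₁−a₂| r³ + (a₁(a₁−a₂) + α/β) r²) − 2α r₁ r − s`
is strictly positive for `r ≥ κ` and `0 ≤ r₁ ≤ κ`. -/
theorem example21_positivity (β α a₁ a₂ s κ : ℝ) (hβ : 0 < β) (hα : 0 < α)
    (ha : a₁ * a₂ < 0)
    (haux : a₁ ^ 2 + a₂ ^ 2 + 2 * (a₁ - a₂) ^ 2 + max (a₁ ^ 2) (a₂ ^ 2) < 8 * α / β)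
    (hs : 0 ≤ s) (hκ0 : 0 < κ) (hκ : κ < min |a₁| |a₂| / 2)
    (hsκ : s < 2 * β * κ ^ 2 * (κ - |a₁ - a₂|) * (κ - min |a₁| |a₂|)) :
    ∀ r₁ ∈ Set.Icc (0 : ℝ) κ, ∀ r : ℝ, κ ≤ r →
      0 < 2 * β * (r ^ 4 - |2 * a₁ - a₂| * r ^ 3 + (a₁ * (a₁ - a₂) + α / β) * r ^ 2)
            - 2 * α * r₁ * r - s := by
  rintro r₁ ⟨-, hr₁⟩ r hr
  have hmul : a₁ * (a₁ - a₂) = |a₁| * (|a₁| + |a₂|) ∧ |a₁ - a₂| = |a₁| + |a₂| ∧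
      |2 * a₁ - a₂| = 2 * |a₁| + |a₂| := by
    rcases mul_neg_iff.1 ha with ⟨h₁, h₂⟩ | ⟨h₁, h₂⟩
    · rw [abs_of_pos h₁, abs_of_neg h₂, abs_of_pos (by linarith : 0 < a₁ - a₂),
        abs_of_pos (by linarith : 0 < 2 * a₁ - a₂)]
      refine ⟨?_, ?_, ?_⟩ <;> ring
    · rw [abs_of_neg h₁, abs_of_pos h₂, abs_of_neg (by linarith : a₁ - a₂ < 0),
        abs_of_neg (by linarith : 2 * a₁ - a₂ < 0)]
      refine ⟨?_, ?_, ?_⟩ <;> ring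
  obtain ⟨hprod, hdiff, hdiff₂⟩ := hmul
  have hsq : (a₁ - a₂) ^ 2 = (|a₁| + |a₂|) ^ 2 := by rw [← hdiff, sq_abs]
  have hmax := le_max_left (a₁ ^ 2) (a₂ ^ 2)
  rw [hsq, mul_div_assoc] at haux
  rw [← sq_abs a₁, ← sq_abs a₂] at haux hmax
  rw [hdiff] at hsκ
  rw [hprod, hdiff₂]
  have hmin := min_le_left |a₁| |a₂|
  have hαA : α = β * (α / β) := by field_simp
  have hA : 0 < α / β := div_pos hα hβ
  have ha₂ := abs_nonneg a₂
  generalize |a₁| = a at *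
  generalize |a₂| = c at *
  generalize min a c = m at *
  generalize α / β = A at *
  subst hαA
  have key := quartic_ge_value_at_left_endpoint (a := a) (c := c) (A := A) ha₂ hκ0.le
    (by linarith) (by nlinarith) hr
  have hs' : s < 2 * β * (κ ^ 2 * (a - κ) * (a + c - κ)) := by
    have h : 0 ≤ (a - m) * (2 * β * κ ^ 2 * (a + c - κ)) :=
      mul_nonneg (by linarith) (mul_nonneg (by positivity) (by linarith))
    linarith
  have hβkey := mul_le_mul_of_nonneg_left key (by positivity : 0 ≤ 2 * β)
  have hr₁' : 0 ≤ 2 * (β * A) * r * (κ - r₁) :=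
    mul_nonneg (mul_nonneg (by positivity) (by linarith)) (by linarith)
  linarith
end

section
/- Let β, α > 0, let a₁, a₂ ∈ ℝ with a₁a₂ < 0 and a₁² + a₂² + 2(a₁ − a₂)² + max(a₁², a₂²) < 8α/β, let H ≥ 0 and s ≥ 0, and let κ ∈ (0, min(|a₁|, |a₂|)/2) satisfy s + Hκ < 2βκ²(κ − |a₁ − a₂|)(κ − min(|a₁|, |a₂|)). Then for every r₁ ∈ [0, κ] and every r ≥ κ: 2β( r⁴ − |2a₁ − a₂| r³ + (a₁(a₁ − a₂) + α/β) r² ) − 2α r₁ r − H r − s > 0. -/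
/-- A quartic is positive on `[κ, ∞)` as soon as it is positive at `κ`, has nonnegative derivative
there, and is convex. -/
theorem quartic_pos_of_le {A B C D κ r : ℝ} (hconv : 3 * A ^ 2 ≤ 8 * B)
    (hval : 0 < κ ^ 4 - A * κ ^ 3 + B * κ ^ 2 - C * κ - D)
    (hder : 0 ≤ 4 * κ ^ 3 - 3 * A * κ ^ 2 + 2 * B * κ - C) (hr : κ ≤ r) :
    0 < r ^ 4 - A * r ^ 3 + B * r ^ 2 - C * r - D := by
  have hquad : 0 ≤ (r - κ) ^ 2 + (4 * κ - A) * (r - κ) + (6 * κ ^ 2 - 3 * A * κ + B) := by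
    nlinarith [sq_nonneg (2 * (r - κ) + (4 * κ - A)), sq_nonneg (4 * κ - A)]
  have h₁ := mul_nonneg hder (sub_nonneg.2 hr)
  have h₂ := mul_nonneg (sq_nonneg (r - κ)) hquad
  linarith

theorem perturbed_quartic_pos {p q c h σ κ r : ℝ} (hp : 0 < p) (hq : 0 < q)
    (hc : p ^ 2 + q ^ 2 + 2 * (p + q) ^ 2 + max (p ^ 2) (q ^ 2) < 8 * c) (hσ : 0 ≤ σ)
    (hκ0 : 0 < κ) (hκ : κ < min p q / 2)
    (hσκ : σ + h * κ < κ ^ 2 * (κ - (p + q)) * (κ - min p q)) (hr : κ ≤ r) :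
    0 < r ^ 4 - (2 * p + q) * r ^ 3 + (p * (p + q) + c) * r ^ 2 - (c * κ + h) * r - σ := by
  have hmp : min p q ≤ p := min_le_left p q
  have hmq : min p q ≤ q := min_le_right p q
  have hmaxp : p ^ 2 ≤ max (p ^ 2) (q ^ 2) := le_max_left _ _
  have hpq : 0 < p * q := mul_pos hp hq
  have hmin : κ ^ 2 * (κ - (p + q)) * (κ - min p q) ≤ κ ^ 2 * (κ - (p + q)) * (κ - p) := by
    have : 0 ≤ κ ^ 2 * (p + q - κ) * (p - min p q) :=
      mul_nonneg (mul_nonneg (sq_nonneg κ) (by linarith)) (by linarith)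
    linarith
  have hh : h ≤ κ * ((p + q - κ) * (p - κ)) := by
    refine le_of_mul_le_mul_right ?_ hκ0
    linarith
  refine quartic_pos_of_le (by nlinarith) (by linarith) ?_ hr
  have hbracket : 0 ≤ p * (p + q) - 2 * κ * (2 * p + q) + 3 * κ ^ 2 + c := by
    nlinarith [sq_nonneg (3 * κ - (2 * p + q))]
  have := mul_nonneg hκ0.le hbracket
  linarith

/-- Polynomial verification in Example 3.1: the dissipativity function of
Example 2.1 perturbed by a bounded drift of size `H` is strictly positive for
`r ≥ κ` and `0 ≤ r₁ ≤ κ`. -/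
theorem example31_positivity (β α a₁ a₂ H s κ : ℝ) (hβ : 0 < β) (hα : 0 < α)
    (ha : a₁ * a₂ < 0)
    (haux : a₁ ^ 2 + a₂ ^ 2 + 2 * (a₁ - a₂) ^ 2 + max (a₁ ^ 2) (a₂ ^ 2) < 8 * α / β)
    (hH : 0 ≤ H) (hs : 0 ≤ s) (hκ0 : 0 < κ) (hκ : κ < min |a₁| |a₂| / 2)
    (hsκ : s + H * κ < 2 * β * κ ^ 2 * (κ - |a₁ - a₂|) * (κ - min |a₁| |a₂|)) :
    ∀ r₁ ∈ Set.Icc (0 : ℝ) κ, ∀ r : ℝ, κ ≤ r →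
      0 < 2 * β * (r ^ 4 - |2 * a₁ - a₂| * r ^ 3 + (a₁ * (a₁ - a₂) + α / β) * r ^ 2)
            - 2 * α * r₁ * r - H * r - s := by
  intro r₁ hr₁ r hr
  have ha₁ : 0 < |a₁| := abs_pos.2 (left_ne_zero_of_mul ha.ne)
  have ha₂ : 0 < |a₂| := abs_pos.2 (right_ne_zero_of_mul ha.ne)
  have hsub : |a₁ - a₂| = |a₁| + |a₂| ∧ |2 * a₁ - a₂| = 2 * |a₁| + |a₂| ∧
      a₁ * (a₁ - a₂) = |a₁| * (|a₁| + |a₂|) := by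
    rcases mul_neg_iff.1 ha with ⟨h₁, h₂⟩ | ⟨h₁, h₂⟩
    · rw [abs_of_pos h₁, abs_of_neg h₂, abs_of_pos (by linarith), abs_of_pos (by linarith)]
      refine ⟨?_, ?_, ?_⟩ <;> ring
    · rw [abs_of_neg h₁, abs_of_pos h₂, abs_of_neg (by linarith), abs_of_neg (by linarith)]
      refine ⟨?_, ?_, ?_⟩ <;> ring
  obtain ⟨h₁, h₂, h₃⟩ := hsub
  rw [← sq_abs (a₁ - a₂), ← sq_abs a₁, ← sq_abs a₂, h₁, mul_div_assoc] at haux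
  rw [h₁] at hsκ
  rw [h₂, h₃]
  have hσκ : s / (2 * β) + H / (2 * β) * κ
      < κ ^ 2 * (κ - (|a₁| + |a₂|)) * (κ - min |a₁| |a₂|) := by
    refine lt_of_mul_lt_mul_left (a := 2 * β) ?_ (by positivity)
    calc 2 * β * (s / (2 * β) + H / (2 * β) * κ) = s + H * κ := by field_simp
      _ < _ := hsκ
      _ = _ := by ring
  have hpos := mul_pos (mul_pos two_pos hβ) (perturbed_quartic_pos ha₁ ha₂ haux
    (by positivity) hκ0 hκ hσκ hr)
  have hr₁κ : 0 ≤ 2 * α * r * (κ - r₁) :=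
    mul_nonneg (mul_nonneg (by positivity) (hκ0.le.trans hr)) (sub_nonneg.2 hr₁.2)
  have hcollect : 2 * β * (r ^ 4 - (2 * |a₁| + |a₂|) * r ^ 3
        + (|a₁| * (|a₁| + |a₂|) + α / β) * r ^ 2 - (α / β * κ + H / (2 * β)) * r - s / (2 * β))
      = 2 * β * (r ^ 4 - (2 * |a₁| + |a₂|) * r ^ 3
        + (|a₁| * (|a₁| + |a₂|) + α / β) * r ^ 2) - 2 * α * κ * r - H * r - s := by
    field_simp
    ring
  linarith
end
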